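/- arXiv:math/0110051 — 3 statements merged into one kernel-verified Lean document; each statement's English description precedes it below -/
import Mathlib

section
/- For every integer n ≥ 1, s(n+1) = 3·s(n) − s(n−1). -/
/-- For every integer n ≥ 1, s(n+1) = 3·s(n) − s(n−1), where the
sequences s, s', s'' satisfy the recursions of §6 of the paper. -/
theorem core_decomposition_count_s_succ
    (s s' s'' : ℕ → ℝ)
    (hs0 : s 0 = 1)
    (hs' : ∀ n : ℕ, 1 ≤ n → s' n = 1 + ∑ h ∈ Finset.Ico 1 n, s'' h)
    (hs'' : ∀ n : ℕ, 1 ≤ n → s'' n = 1 + ∑ h ∈ Finset.Ico 1 n, s h)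
    (hs : ∀ n : ℕ, 1 ≤ n → s n = s' n + s'' n) :
    ∀ n : ℕ, 1 ≤ n → s (n + 1) = 3 * s n - s (n - 1) := by
  have step' : ∀ n : ℕ, 1 ≤ n → s' (n + 1) = s' n + s'' n := by
    intro n hn
    rw [hs' (n + 1) (by omega), hs' n hn, Finset.sum_Ico_succ_top hn]
    ring
  have step'' : ∀ n : ℕ, 1 ≤ n → s'' (n + 1) = s'' n + s n := by
    intro n hn
    rw [hs'' (n + 1) (by omega), hs'' n hn, Finset.sum_Ico_succ_top hn]
    ring
  have step : ∀ n : ℕ, 1 ≤ n → s (n + 1) = 2 * s n + s'' n := by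
    intro n hn
    rw [hs (n + 1) (by omega), step' n hn, step'' n hn, hs n hn]
    ring
  intro n hn
  obtain rfl | ⟨m, hm, rfl⟩ : n = 1 ∨ ∃ m, 1 ≤ m ∧ n = m + 1 := by
    rcases hn.eq_or_lt with h | h
    · exact Or.inl h.symm
    · exact Or.inr ⟨n - 1, by omega, by omega⟩
  · have h' : s' 1 = 1 := by simpa using hs' 1 le_rfl
    have h'' : s'' 1 = 1 := by simpa using hs'' 1 le_rfl
    have h1 := hs 1 le_rfl
    rw [step 1 le_rfl, Nat.sub_self, hs0]
    linarith
  · rw [Nat.add_sub_cancel, step (m + 1) hn, step'' m hm]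
    linarith [step m hm]
end

section
/- Let α = (3 + √5)/2 and β = (3 − √5)/2. Then for every integer n ≥ 0, s(n) = ((1 + √5)/(2·√5))·α^n + ((√5 − 1)/(2·√5))·β^n. -/
/-- With α = (3 + √5)/2 and β = (3 − √5)/2, for every integer n ≥ 0,
s(n) = ((1 + √5)/(2·√5))·α^n + ((√5 − 1)/(2·√5))·β^n. -/
theorem core_decomposition_count_s_closed_form
    (s s' s'' : ℕ → ℝ)
    (hs0 : s 0 = 1)
    (hs' : ∀ n : ℕ, 1 ≤ n → s' n = 1 + ∑ h ∈ Finset.Ico 1 n, s'' h)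
    (hs'' : ∀ n : ℕ, 1 ≤ n → s'' n = 1 + ∑ h ∈ Finset.Ico 1 n, s h)
    (hs : ∀ n : ℕ, 1 ≤ n → s n = s' n + s'' n) :
    ∀ n : ℕ,
      s n = ((1 + Real.sqrt 5) / (2 * Real.sqrt 5)) * ((3 + Real.sqrt 5) / 2) ^ n
          + ((Real.sqrt 5 - 1) / (2 * Real.sqrt 5)) * ((3 - Real.sqrt 5) / 2) ^ n := by
  have hr : Real.sqrt 5 * Real.sqrt 5 = 5 := Real.mul_self_sqrt (by norm_num)
  have hr0 : Real.sqrt 5 ≠ 0 := by positivity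
  generalize Real.sqrt 5 = r at hr hr0 ⊢
  have hα : (1 + r) / (2 * r) = (5 + r) / 10 := by
    field_simp
    linear_combination -2 * hr
  have hβ : (r - 1) / (2 * r) = (5 - r) / 10 := by
    field_simp
    linear_combination 2 * hr
  rw [hα, hβ]
  have s'_one : s' 1 = 1 := by simp [hs' 1 le_rfl]
  have s''_one : s'' 1 = 1 := by simp [hs'' 1 le_rfl]
  have s'_succ : ∀ n : ℕ, 1 ≤ n → s' (n + 1) = s' n + s'' n := fun n hn => by
    rw [hs' (n + 1) (by omega), hs' n hn, Finset.sum_Ico_succ_top hn, add_assoc]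
  have s''_succ : ∀ n : ℕ, 1 ≤ n → s'' (n + 1) = s'' n + s n := fun n hn => by
    rw [hs'' (n + 1) (by omega), hs'' n hn, Finset.sum_Ico_succ_top hn, add_assoc]
  have key : ∀ n : ℕ, 1 ≤ n →
      s n = (5 + r) / 10 * ((3 + r) / 2) ^ n + (5 - r) / 10 * ((3 - r) / 2) ^ n ∧
      s'' n = r / 5 * (((3 + r) / 2) ^ n - ((3 - r) / 2) ^ n) := by
    intro n hn
    induction n, hn using Nat.le_induction with
    | base =>
      rw [hs 1 le_rfl, s'_one, s''_one]
      constructor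
      · linear_combination -(1 / 10) * hr
      · linear_combination -(1 / 5) * hr
    | succ n hn ih =>
      obtain ⟨h, h''⟩ := ih
      have hsucc : s (n + 1) = 2 * s n + s'' n := by
        rw [hs (n + 1) (by omega), s'_succ n hn, s''_succ n hn, ← hs n hn]
        ring
      rw [hsucc, s''_succ n hn, h, h'', pow_succ, pow_succ]
      generalize ((3 + r) / 2) ^ n = a
      generalize ((3 - r) / 2) ^ n = b
      constructor
      · linear_combination -((a + b) / 20) * hr
      · linear_combination -((a + b) / 10) * hr
  intro n
  rcases Nat.eq_zero_or_pos n with rfl | hn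
  · rw [hs0]
    ring
  · exact (key n hn).1
end

section
/- Let α = (3 + √5)/2 and β = (3 − √5)/2. Then for every integer n ≥ 0, c(n) = (α^{n+1} − β^{n+1})/√5. -/
/-- The solution of `u (n + 2) = 3 * u (n + 1) - u n` with `u 0 = 1` and `u 1 = 3`. -/
theorem eq_binet_of_recurrence (u : ℕ → ℝ) (h0 : u 0 = 1) (h1 : u 1 = 3)
    (hrec : ∀ n, u (n + 2) = 3 * u (n + 1) - u n) (n : ℕ) :
    u n = (((3 + Real.sqrt 5) / 2) ^ (n + 1) - ((3 - Real.sqrt 5) / 2) ^ (n + 1))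
            / Real.sqrt 5 := by
  have h5 : Real.sqrt 5 ≠ 0 := by positivity
  have hsq : Real.sqrt 5 ^ 2 = 5 := Real.sq_sqrt (by norm_num)
  have hα : ((3 + Real.sqrt 5) / 2) ^ 2 = 3 * ((3 + Real.sqrt 5) / 2) - 1 := by
    linear_combination hsq / 4
  have hβ : ((3 - Real.sqrt 5) / 2) ^ 2 = 3 * ((3 - Real.sqrt 5) / 2) - 1 := by
    linear_combination hsq / 4
  rw [eq_div_iff h5]
  induction n using Nat.twoStepInduction with
  | zero => rw [h0]; ring
  | one => rw [h1]; ring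
  | more n ih₀ ih₁ =>
    rw [hrec]
    linear_combination 3 * ih₁ - ih₀ - ((3 + Real.sqrt 5) / 2) ^ (n + 1) * hα
      + ((3 - Real.sqrt 5) / 2) ^ (n + 1) * hβ


/-- With α = (3 + √5)/2 and β = (3 − √5)/2, and c(n) = Σ_{m=0}^{n} s(m),
for every integer n ≥ 0, c(n) = (α^(n+1) − β^(n+1))/√5. -/
theorem core_decomposition_count_c_closed_form
    (s s' s'' c : ℕ → ℝ)
    (hs0 : s 0 = 1)
    (hs' : ∀ n : ℕ, 1 ≤ n → s' n = 1 + ∑ h ∈ Finset.Ico 1 n, s'' h)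
    (hs'' : ∀ n : ℕ, 1 ≤ n → s'' n = 1 + ∑ h ∈ Finset.Ico 1 n, s h)
    (hs : ∀ n : ℕ, 1 ≤ n → s n = s' n + s'' n)
    (hc : ∀ n : ℕ, c n = ∑ m ∈ Finset.range (n + 1), s m) :
    ∀ n : ℕ,
      c n = (((3 + Real.sqrt 5) / 2) ^ (n + 1) - ((3 - Real.sqrt 5) / 2) ^ (n + 1))
              / Real.sqrt 5 := by
  have hc_succ (n : ℕ) : c (n + 1) = c n + s (n + 1) := by
    rw [hc, hc, Finset.sum_range_succ]
  have hc0 : c 0 = 1 := by simp [hc, hs0]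
  have hs''_succ (n : ℕ) : s'' (n + 1) = c n := by
    rw [hs'' _ (by omega), hc, Finset.range_eq_Ico,
      Finset.sum_eq_sum_Ico_succ_bot n.succ_pos, hs0]
  have hs'_one : s' 1 = 1 := by simp [hs']
  have hs'_succ (n : ℕ) : s' (n + 2) = s' (n + 1) + c n := by
    rw [hs' _ (by omega), hs' (n + 1) (by omega), Finset.sum_Ico_succ_top (by omega),
      hs''_succ, add_assoc]
  have hstep (n : ℕ) : c (n + 1) = 2 * c n + s' (n + 1) := by
    rw [hc_succ, hs _ (by omega), hs''_succ]
    ring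
  refine eq_binet_of_recurrence c hc0 ?_ fun n => ?_
  · rw [hstep, hc0, hs'_one]
    norm_num
  · linear_combination hstep (n + 1) - hstep n + hs'_succ n
end
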